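/- arXiv:1610.02934 — 2 statements merged into one kernel-verified Lean document; each statement's English description precedes it below -/
import Mathlib

section
/- Let T be a triangulation of the completed ∞-gon and let θ = (θ_i)_{i∈I} be a T-admissible sequence such that μ_θ(T) is a triangulation. If δ is a mutable arc in μ_θ(T), then there exists r ∈ I such that for all l ∈ I with l ≥ r the sequence θ ∪_l (δ) = (θ_1, …, θ_l, δ, θ_{l+1}, θ_{l+2}, …) obtained by inserting δ after position l is T-admissible, and μ_{θ∪_l(δ)}(γ) = μ_δ(μ_θ(γ)) for all γ ∈ T. -/
open scoped Classical

/-- Vertices of the completed ∞-gon: `ℤ ∪ {−∞, +∞}` with the extended linear order. -/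
abbrev Vtx : Type := WithBot (WithTop ℤ)

/-- The vertex corresponding to an integer. -/
def vInt (m : ℤ) : Vtx := ((m : WithTop ℤ) : Vtx)

/-- The vertex `+∞`. -/
def vTop : Vtx := ((⊤ : WithTop ℤ) : Vtx)

/-- The vertex `−∞`. -/
def vBot : Vtx := (⊥ : Vtx)

/-- An arc of the completed ∞-gon: a pair of vertices `src < tgt` such that if both
endpoints are integers then they differ by at least `2`. -/
structure Arc where
  src : Vtx
  tgt : Vtx
  lt : src < tgt
  sep : ∀ m n : ℤ, src = vInt m → tgt = vInt n → m + 2 ≤ n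

/-- Two arcs `(a,b)` and `(c,d)` cross if `a < c < b < d` or `c < a < d < b`. -/
def Cross (x y : Arc) : Prop :=
  (x.src < y.src ∧ y.src < x.tgt ∧ x.tgt < y.tgt) ∨
  (y.src < x.src ∧ x.src < y.tgt ∧ y.tgt < x.tgt)

/-- A triangulation of the completed ∞-gon: a maximal set of pairwise compatible
(= non-crossing) arcs. -/
def IsTriangulation (T : Set Arc) : Prop :=
  (∀ x ∈ T, ∀ y ∈ T, ¬ Cross x y) ∧
  ∀ γ : Arc, (∀ x ∈ T, ¬ Cross γ x) → γ ∈ T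

lemma vInt_lt_vTop (m : ℤ) : vInt m < vTop := by
  simpa [vInt, vTop] using WithBot.coe_lt_coe.mpr (WithTop.coe_lt_top (m : ℤ))

lemma vBot_lt_vInt (m : ℤ) : vBot < vInt m := WithBot.bot_lt_coe _

lemma vBot_lt_vTop : vBot < vTop := WithBot.bot_lt_coe _

lemma vTop_ne_vInt (n : ℤ) : vTop ≠ vInt n := by simp [vTop, vInt]

lemma vBot_ne_vInt (n : ℤ) : vBot ≠ vInt n := by simp [vBot, vInt]

/-- The Prüfer curve `π_m = (m, +∞)`. -/
def prufer (m : ℤ) : Arc :=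
  ⟨vInt m, vTop, vInt_lt_vTop m, fun _ n _ h => absurd h (vTop_ne_vInt n)⟩

/-- The adic curve `α_m = (−∞, m)`. -/
def adic (m : ℤ) : Arc :=
  ⟨vBot, vInt m, vBot_lt_vInt m, fun k _ h _ => absurd h (vBot_ne_vInt k)⟩

/-- The generic curve `z = (−∞, +∞)`. -/
def generic : Arc :=
  ⟨vBot, vTop, vBot_lt_vTop, fun k _ h _ => absurd h (vBot_ne_vInt k)⟩

/-- `T` contains an arc with endpoints `x` and `y`. -/
def HasArc (T : Set Arc) (x y : Vtx) : Prop := ∃ γ ∈ T, γ.src = x ∧ γ.tgt = y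

/-- `T` has a right fountain at the integer `n`. -/
def RightFountainInt (T : Set Arc) (n : ℤ) : Prop :=
  {p : ℤ | HasArc T (vInt n) (vInt p)}.Infinite

/-- `T` has a left fountain at the integer `n`. -/
def LeftFountainInt (T : Set Arc) (n : ℤ) : Prop :=
  {p : ℤ | HasArc T (vInt p) (vInt n)}.Infinite

/-- `T` has a right fountain at the vertex `v`. -/
def RightFountain (T : Set Arc) (v : Vtx) : Prop :=
  (∃ n : ℤ, v = vInt n ∧ RightFountainInt T n) ∨
  (v = vTop ∧ {p : ℤ | 0 ≤ p ∧ prufer p ∈ T}.Infinite) ∨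
  (v = vBot ∧ {p : ℤ | 0 ≤ p ∧ adic p ∈ T}.Infinite)

/-- `T` has a left fountain at the vertex `v`. -/
def LeftFountain (T : Set Arc) (v : Vtx) : Prop :=
  (∃ n : ℤ, v = vInt n ∧ LeftFountainInt T n) ∨
  (v = vTop ∧ {p : ℤ | p ≤ 0 ∧ prufer p ∈ T}.Infinite) ∨
  (v = vBot ∧ {p : ℤ | p ≤ 0 ∧ adic p ∈ T}.Infinite)

/-- `T` is locally finite if every vertex is an endpoint of only finitely many arcs of `T`. -/
def LocallyFin (T : Set Arc) : Prop :=
  ∀ v : Vtx, {γ | γ ∈ T ∧ (γ.src = v ∨ γ.tgt = v)}.Finite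

/-- An arc is peripheral if both endpoints are integers. -/
def IsPeripheral (γ : Arc) : Prop :=
  (∃ m : ℤ, γ.src = vInt m) ∧ ∃ n : ℤ, γ.tgt = vInt n

/-- `γ'` is an exchange partner for `γ` relative to `T`:
it is distinct from `γ` and `(T \ {γ}) ∪ {γ'}` is again a triangulation. -/
def MutExchange (T : Set Arc) (γ γ' : Arc) : Prop :=
  γ' ≠ γ ∧ IsTriangulation ((T \ {γ}) ∪ {γ'})

/-- `γ` is a mutable arc of `T`. -/
def IsMutable (T : Set Arc) (γ : Arc) : Prop :=
  γ ∈ T ∧ ∃ γ', MutExchange T γ γ'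

/-- The (unique) replacement arc of `γ` in `T`, when `γ` is mutable. -/
noncomputable def flipArc (T : Set Arc) (γ : Arc) : Arc :=
  if h : ∃ γ', MutExchange T γ γ' then h.choose else γ

/-- The mutation `μ_γ(T)` of `T` at `γ`. -/
noncomputable def mutate (T : Set Arc) (γ : Arc) : Set Arc :=
  (T \ {γ}) ∪ {flipArc T γ}

/-- `μ_γ(δ)`: the effect of the mutation of `T` at `γ` on the arc `δ`. -/
noncomputable def mutArc (T : Set Arc) (γ δ : Arc) : Arc :=
  if δ = γ then flipArc T γ else δ

/-- One step of a mutation sequence on a set of arcs (`none` = no entry). -/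
noncomputable def stepT (T : Set Arc) : Option Arc → Set Arc
  | none => T
  | some γ => mutate T γ

/-- One step of a mutation sequence on a single arc. -/
noncomputable def stepA (T : Set Arc) : Option Arc → Arc → Arc
  | none, δ => δ
  | some γ, δ => mutArc T γ δ

/-- `iterT T θ k` is `μ_{θ_k} ∘ ⋯ ∘ μ_{θ_1}(T)`. Sequences (finite or infinite) are
encoded as `θ : ℕ → Option Arc` whose support is downward closed. -/
noncomputable def iterT (T : Set Arc) (θ : ℕ → Option Arc) : ℕ → Set Arc
  | 0 => T
  | k + 1 => stepT (iterT T θ k) (θ k)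

/-- `iterA T θ γ k` is `μ_{θ_k} ∘ ⋯ ∘ μ_{θ_1}(γ)`. -/
noncomputable def iterA (T : Set Arc) (θ : ℕ → Option Arc) (γ : Arc) : ℕ → Arc
  | 0 => γ
  | k + 1 => stepA (iterT T θ k) (θ k) (iterA T θ γ k)

/-- `θ` is a `T`-admissible sequence: its support is downward closed (so it is a genuine
finite or infinite sequence), each entry is mutable in the triangulation obtained by the
previous mutations, and the mutation of each arc of `T` along `θ` eventually stabilizes. -/
def Admissible (T : Set Arc) (θ : ℕ → Option Arc) : Prop :=
  (∀ i, θ i = none → θ (i + 1) = none) ∧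
  (∀ i γ, θ i = some γ → IsMutable (iterT T θ i) γ) ∧
  (∀ γ ∈ T, ∃ l, ∀ k, l ≤ k → iterA T θ γ k = iterA T θ γ l)

/-- `μ_θ(γ)`: the stable value of the mutation of the arc `γ` along the sequence `θ`. -/
noncomputable def seqLimit (T : Set Arc) (θ : ℕ → Option Arc) (γ : Arc) : Arc :=
  if h : ∃ l, ∀ k, l ≤ k → iterA T θ γ k = iterA T θ γ l
  then iterA T θ γ h.choose else γ

/-- `μ_θ(T)`: the mutation of `T` along the sequence `θ`. -/
noncomputable def mutSeq (T : Set Arc) (θ : ℕ → Option Arc) : Set Arc :=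
  seqLimit T θ '' T

/-- The sequence `θ` leaves the arc `γ` untouched. -/
def Untouched (T : Set Arc) (θ : ℕ → Option Arc) (γ : Arc) : Prop :=
  ∀ l, iterA T θ γ l = γ

/-- The quadrilateral `S(γ)` of a mutable arc `γ` in `T`: with `v₁ < v₂ < v₃ < v₄` the four
endpoints of the two diagonals `γ` and `flipArc T γ`, it consists of those of the pairs
`(v₁,v₂), (v₂,v₃), (v₃,v₄), (v₁,v₄)` that are arcs. -/
noncomputable def quad (T : Set Arc) (γ : Arc) : Set Arc :=
  let γ' := flipArc T γ
  let vs : Vtx × Vtx × Vtx × Vtx :=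
    if γ.src < γ'.src then (γ.src, γ'.src, γ.tgt, γ'.tgt) else (γ'.src, γ.src, γ'.tgt, γ.tgt)
  {δ : Arc | (δ.src = vs.1 ∧ δ.tgt = vs.2.1) ∨ (δ.src = vs.2.1 ∧ δ.tgt = vs.2.2.1) ∨
    (δ.src = vs.2.2.1 ∧ δ.tgt = vs.2.2.2) ∨ (δ.src = vs.1 ∧ δ.tgt = vs.2.2.2)}

/-- The set `𝒫` of Prüfer curves compatible with every arc of `S`. -/
def pruferCompletion (S : Set Arc) : Set Arc :=
  {γ | (∃ k : ℤ, γ = prufer k) ∧ ∀ x ∈ S, ¬ Cross γ x}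

/-- The set `𝒜̃` of adic curves compatible with every arc of `S ∪ 𝒫(S)`. -/
def adicCompletion' (S : Set Arc) : Set Arc :=
  {γ | (∃ k : ℤ, γ = adic k) ∧ ∀ x ∈ S ∪ pruferCompletion S, ¬ Cross γ x}

/-- The completed (Prüfer) mutation `μ̄_θ(T) = μ_θ(T) ∪ 𝒫 ∪ 𝒜̃` of `T` along `θ`. -/
noncomputable def completedMut (T : Set Arc) (θ : ℕ → Option Arc) : Set Arc :=
  mutSeq T θ ∪ pruferCompletion (mutSeq T θ) ∪ adicCompletion' (mutSeq T θ)

/-- The tower of triangulations associated to a composition of completed mutations. -/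
noncomputable def compIter (T : Set Arc) (Θ : ℕ → Option (ℕ → Option Arc)) : ℕ → Set Arc
  | 0 => T
  | k + 1 =>
    match Θ k with
    | none => compIter T Θ k
    | some θ => completedMut (compIter T Θ k) θ

/-- `Θ` is a `T`-admissible composition of completed mutations. -/
def CompAdmissible (T : Set Arc) (Θ : ℕ → Option (ℕ → Option Arc)) : Prop :=
  (∀ i, Θ i = none → Θ (i + 1) = none) ∧
  ∀ i θ, Θ i = some θ → Admissible (compIter T Θ i) θ

/-- The transfinite mutation of `T` along the composition `Θ`. -/
noncomputable def transfiniteMut (T : Set Arc) (Θ : ℕ → Option (ℕ → Option Arc)) : Set Arc :=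
  ⋃ i, {γ ∈ compIter T Θ i |
    ∀ k, i ≤ k → ∀ θ, Θ k = some θ → Untouched (compIter T Θ k) θ γ}

/-- `l` is a valid insertion position for the sequence `θ`: all earlier entries exist. -/
def ValidPos (θ : ℕ → Option Arc) (l : ℕ) : Prop := ∀ k < l, (θ k).isSome

/-- `θ ∪_l (δ)`: the sequence obtained from `θ` by inserting `δ` after the first `l`
entries. -/
def insertAt (θ : ℕ → Option Arc) (l : ℕ) (δ : Arc) : ℕ → Option Arc :=
  fun k => if k < l then θ k else if k = l then some δ else θ (k - 1)

/-! ### Auxiliary material for the proof -/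

lemma Arc.ext' {x y : Arc} (h1 : x.src = y.src) (h2 : x.tgt = y.tgt) : x = y := by
  cases x; cases y; simp at h1 h2; subst h1 h2; rfl

lemma Cross.symm {x y : Arc} (h : Cross x y) : Cross y x := Or.symm h

lemma not_cross_self (x : Arc) : ¬ Cross x x := by
  rintro (h | h) <;> exact lt_irrefl _ h.1

/-- Arc between two vertices with a vertex strictly in between. -/
lemma exists_arc {a b c : Vtx} (h1 : a < c) (h2 : c < b) :
    ∃ s : Arc, s.src = a ∧ s.tgt = b := by
  refine ⟨⟨a, b, h1.trans h2, ?_⟩, rfl, rfl⟩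
  rintro m n rfl rfl
  have hc : ∃ k : ℤ, c = vInt k := by
    induction c using WithBot.recBotCoe with
    | bot => exact absurd h1 not_lt_bot
    | coe c =>
      induction c using WithTop.recTopCoe with
      | top =>
        exact absurd (h2.trans (vInt_lt_vTop n)) (lt_irrefl _)
      | coe k => exact ⟨k, rfl⟩
  obtain ⟨k, rfl⟩ := hc
  have e1 : m < k := by simpa [vInt] using h1
  have e2 : k < n := by simpa [vInt] using h2
  omega

/-- `s` is a side of the quadrilateral with diagonals `x` and `y`. -/
def IsSide (x y s : Arc) : Prop :=
  (s.src = x.src ∨ s.src = x.tgt ∨ s.src = y.src ∨ s.src = y.tgt) ∧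
  (s.tgt = x.src ∨ s.tgt = x.tgt ∨ s.tgt = y.src ∨ s.tgt = y.tgt) ∧
  ¬ Cross x s ∧ ¬ Cross y s

lemma side_finite (x y : Arc) : {s | IsSide x y s}.Finite := by
  let F : Set Vtx := {x.src, x.tgt, y.src, y.tgt}
  have hF : F.Finite := by simp [F]
  have hinj : Function.Injective (fun s : Arc => (s.src, s.tgt)) := by
    intro s t h
    simp only [Prod.mk.injEq] at h
    exact Arc.ext' h.1 h.2
  refine ((hF.prod hF).preimage hinj.injOn).subset ?_
  intro s hs
  simp only [Set.mem_preimage, Set.mem_prod, F, Set.mem_insert_iff, Set.mem_singleton_iff]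
  exact ⟨hs.1, hs.2.1⟩

lemma order_aux {v₁ v₂ v₃ v₄ p q : Vtx} (h12 : v₁ < v₂) (h23 : v₂ < v₃) (h34 : v₃ < v₄)
    (hpq : p < q)
    (c12 : ¬ ((p < v₁ ∧ v₁ < q ∧ q < v₂) ∨ (v₁ < p ∧ p < v₂ ∧ v₂ < q)))
    (c23 : ¬ ((p < v₂ ∧ v₂ < q ∧ q < v₃) ∨ (v₂ < p ∧ p < v₃ ∧ v₃ < q)))
    (c34 : ¬ ((p < v₃ ∧ v₃ < q ∧ q < v₄) ∨ (v₃ < p ∧ p < v₄ ∧ v₄ < q)))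
    (c14 : ¬ ((p < v₁ ∧ v₁ < q ∧ q < v₄) ∨ (v₁ < p ∧ p < v₄ ∧ v₄ < q))) :
    ((p < v₁ ∧ v₁ < q ∧ q < v₃) ∨ (v₁ < p ∧ p < v₃ ∧ v₃ < q) → p = v₂ ∧ q = v₄) ∧
    ((p < v₂ ∧ v₂ < q ∧ q < v₄) ∨ (v₂ < p ∧ p < v₄ ∧ v₄ < q) → p = v₁ ∧ q = v₃) := by
  grind

lemma side_pair {x y z : Arc} {a b : Vtx} (hab : a < b)
    (ha : a = x.src ∨ a = x.tgt ∨ a = y.src ∨ a = y.tgt)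
    (hb : b = x.src ∨ b = x.tgt ∨ b = y.src ∨ b = y.tgt)
    (hx : ¬ ((x.src < a ∧ a < x.tgt ∧ x.tgt < b) ∨ (a < x.src ∧ x.src < b ∧ b < x.tgt)))
    (hy : ¬ ((y.src < a ∧ a < y.tgt ∧ y.tgt < b) ∨ (a < y.src ∧ y.src < b ∧ b < y.tgt)))
    (hz : ∀ s, IsSide x y s → ¬ Cross z s) :
    ¬ ((z.src < a ∧ a < z.tgt ∧ z.tgt < b) ∨ (a < z.src ∧ z.src < b ∧ b < z.tgt)) := by
  intro h
  have : ∃ s : Arc, s.src = a ∧ s.tgt = b := by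
    rcases h with h | h
    · exact exists_arc h.2.1 h.2.2
    · exact exists_arc h.1 h.2.1
  obtain ⟨s, rfl, rfl⟩ := this
  exact hz s ⟨ha, hb, hx, hy⟩ h

lemma eq_of_cross {x y z : Arc} (hxy : Cross x y) (hzx : Cross z x)
    (hz : ∀ s, IsSide x y s → ¬ Cross z s) : z = y := by
  rcases hxy with ⟨h1, h2, h3⟩ | ⟨h1, h2, h3⟩
  · have := order_aux h1 h2 h3 z.lt
      (side_pair (x := x) (y := y) h1 (by simp) (by simp) (by grind) (by grind) hz)
      (side_pair (x := x) (y := y) h2 (by simp) (by simp) (by grind) (by grind) hz)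
      (side_pair (x := x) (y := y) h3 (by simp) (by simp) (by grind) (by grind) hz)
      (side_pair (x := x) (y := y) (h1.trans (h2.trans h3))
        (by simp) (by simp) (by grind) (by grind) hz)
    have := this.1 hzx
    exact Arc.ext' this.1 this.2
  · have := order_aux h1 h2 h3 z.lt
      (side_pair (x := x) (y := y) h1 (by simp) (by simp) (by grind) (by grind) hz)
      (side_pair (x := x) (y := y) h2 (by simp) (by simp) (by grind) (by grind) hz)
      (side_pair (x := x) (y := y) h3 (by simp) (by simp) (by grind) (by grind) hz)
      (side_pair (x := x) (y := y) (h1.trans (h2.trans h3))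
        (by simp) (by simp) (by grind) (by grind) hz)
    have := this.2 hzx
    exact Arc.ext' this.1 this.2

lemma IsSide.swap {x y s : Arc} (h : IsSide x y s) : IsSide y x s := by
  unfold IsSide at *; tauto

lemma cross_side {x y s z : Arc} (hxy : Cross x y) (hs : IsSide x y s) (hz : Cross z s) :
    Cross z x ∨ Cross z y := by
  obtain ⟨h1, h2, h3, h4⟩ := hs
  have e1 := s.lt
  have e2 := z.lt
  unfold Cross at *
  rcases hxy with ⟨g1, g2, g3⟩ | ⟨g1, g2, g3⟩ <;>
  rcases h1 with h1 | h1 | h1 | h1 <;> rcases h2 with h2 | h2 | h2 | h2 <;>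
  rw [h1, h2] at e1 h3 h4 hz <;> grind

lemma MutExchange.cross {T : Set Arc} {x y : Arc} (hT : IsTriangulation T) (hx : x ∈ T)
    (h : MutExchange T x y) : Cross x y := by
  by_contra hc
  have hyT : y ∈ T := by
    refine hT.2 y fun z hz => ?_
    by_cases hzx : z = x
    · subst hzx; exact fun h' => hc h'.symm
    · exact h.2.1 y (by simp) z (by simp [hz, hzx])
  have : x ∈ (T \ {x}) ∪ {y} := by
    refine h.2.2 x fun z hz => ?_
    rcases hz with hz | hz
    · exact hT.1 x hx z hz.1
    · rw [hz]; exact hc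
  rcases this with h' | h'
  · exact h'.2 rfl
  · exact h.1 h'.symm

lemma MutExchange.side_mem {T : Set Arc} {x y s : Arc} (hT : IsTriangulation T) (hx : x ∈ T)
    (h : MutExchange T x y) (hs : IsSide x y s) : s ∈ T := by
  have hc := h.cross hT hx
  refine hT.2 s fun z hz hsz => ?_
  by_cases hzx : z = x
  · subst hzx; exact hs.2.2.1 hsz.symm
  · rcases cross_side hc hs hsz.symm with h' | h'
    · exact hT.1 z hz x hx h'
    · exact h.2.1 z (by simp [hz, hzx]) y (by simp) h'

lemma IsSide.ne {x y s : Arc} (hc : Cross x y) (hs : IsSide x y s) : s ≠ x := by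
  rintro rfl; exact hs.2.2.2 hc.symm

lemma MutExchange.unique {T : Set Arc} {x y z : Arc} (hT : IsTriangulation T) (hx : x ∈ T)
    (h : MutExchange T x y) (h' : MutExchange T x z) : z = y := by
  have hc := h.cross hT hx
  refine eq_of_cross hc (h'.cross hT hx).symm fun s hs => ?_
  refine h'.2.1 z (by simp) s (Or.inl ⟨h.side_mem hT hx hs, hs.ne hc⟩)

lemma mutExchange_of_sides {T : Set Arc} {x y : Arc} (hT : IsTriangulation T) (hx : x ∈ T)
    (hc : Cross x y) (hs : ∀ s, IsSide x y s → s ∈ T) : MutExchange T x y := by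
  have key : ∀ z ∈ T, z ≠ x → ¬ Cross z y := by
    intro z hz hzx hzy
    exact hzx (eq_of_cross hc.symm hzy fun s h => hT.1 z hz s (hs s h.swap))
  have hyx : y ≠ x := by rintro rfl; exact not_cross_self _ hc
  refine ⟨hyx, ?_, ?_⟩
  · rintro a (⟨ha, hax⟩ | rfl) b (⟨hb, hbx⟩ | rfl)
    · exact hT.1 a ha b hb
    · exact key a ha hax
    · exact fun h => key b hb hbx h.symm
    · exact not_cross_self _
  · intro z hz
    by_cases hzx : Cross z x
    · right
      exact eq_of_cross hc hzx fun s h => hz s (Or.inl ⟨hs s h, h.ne hc⟩)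
    · left
      refine ⟨hT.2 z fun w hw => ?_, ?_⟩
      · by_cases h : w = x
        · rw [h]; exact hzx
        · exact hz w (Or.inl ⟨hw, h⟩)
      · rintro rfl
        exact hz y (by simp) hc

lemma IsMutable.spec {T : Set Arc} {x : Arc} (h : IsMutable T x) :
    MutExchange T x (flipArc T x) := by
  unfold flipArc
  rw [dif_pos h.2]
  exact h.2.choose_spec

lemma flipArc_eq {T : Set Arc} {x y : Arc} (hT : IsTriangulation T) (hx : x ∈ T)
    (h : MutExchange T x y) : flipArc T x = y :=
  h.unique hT hx (IsMutable.spec ⟨hx, y, h⟩)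

lemma iterT_tri {T : Set Arc} (hT : IsTriangulation T) {θ : ℕ → Option Arc}
    (h : ∀ i γ, θ i = some γ → IsMutable (iterT T θ i) γ) (k : ℕ) :
    IsTriangulation (iterT T θ k) := by
  induction k with
  | zero => exact hT
  | succ k ih =>
    rw [iterT]
    cases hk : θ k with
    | none => exact ih
    | some γ => exact (h k γ hk).spec.2

lemma iterA_mem {T : Set Arc} {θ : ℕ → Option Arc} {γ : Arc} (hγ : γ ∈ T) (k : ℕ) :
    iterA T θ γ k ∈ iterT T θ k := by
  induction k with
  | zero => exact hγ
  | succ k ih =>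
    rw [iterT, iterA]
    cases hk : θ k with
    | none => exact ih
    | some x =>
      simp only [stepA, stepT, mutArc, mutate]
      split_ifs with h
      · simp
      · exact Or.inl ⟨ih, h⟩

lemma seqLimit_eq {T : Set Arc} {θ : ℕ → Option Arc} {γ v : Arc} {l : ℕ}
    (h : ∀ k, l ≤ k → iterA T θ γ k = v) : seqLimit T θ γ = v := by
  have hex : ∃ l, ∀ k, l ≤ k → iterA T θ γ k = iterA T θ γ l :=
    ⟨l, fun k hk => by rw [h k hk, h l le_rfl]⟩
  unfold seqLimit
  rw [dif_pos hex, ← hex.choose_spec _ (le_max_left hex.choose l)]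
  exact h _ (le_max_right _ _)

lemma seqLimit_spec {T : Set Arc} {θ : ℕ → Option Arc} (hθ : Admissible T θ) {γ : Arc}
    (hγ : γ ∈ T) : ∃ l, ∀ k, l ≤ k → iterA T θ γ k = seqLimit T θ γ := by
  obtain ⟨l, hl⟩ := hθ.2.2 γ hγ
  exact ⟨l, fun k hk => by rw [hl k hk, seqLimit_eq hl]⟩

lemma mem_eventually {T : Set Arc} {θ : ℕ → Option Arc} (hθ : Admissible T θ) {s : Arc}
    (hs : s ∈ mutSeq T θ) : ∀ᶠ k in Filter.atTop, s ∈ iterT T θ k := by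
  obtain ⟨γ, hγ, rfl⟩ := hs
  obtain ⟨l, hl⟩ := seqLimit_spec hθ hγ
  filter_upwards [Filter.eventually_ge_atTop l] with k hk
  rw [← hl k hk]
  exact iterA_mem hγ k

lemma none_of_le {θ : ℕ → Option Arc} (h : ∀ i, θ i = none → θ (i + 1) = none) {n k : ℕ}
    (hn : θ n = none) (hk : n ≤ k) : θ k = none := by
  induction k, hk using Nat.le_induction with
  | base => exact hn
  | succ k _ ih => exact h k ih

lemma iterT_const {T : Set Arc} {θ : ℕ → Option Arc} (h : ∀ i, θ i = none → θ (i + 1) = none)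
    {n k : ℕ} (hn : θ n = none) (hk : n ≤ k) : iterT T θ k = iterT T θ n := by
  induction k, hk using Nat.le_induction with
  | base => rfl
  | succ k hk ih => rw [iterT, none_of_le h hn hk]; exact ih

lemma insertAt_lt {θ : ℕ → Option Arc} {l k : ℕ} {δ : Arc} (h : k < l) :
    insertAt θ l δ k = θ k := by simp [insertAt, h]

lemma insertAt_self {θ : ℕ → Option Arc} {l : ℕ} {δ : Arc} :
    insertAt θ l δ l = some δ := by simp [insertAt]

lemma insertAt_succ {θ : ℕ → Option Arc} {l k : ℕ} {δ : Arc} (h : l ≤ k) :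
    insertAt θ l δ (k + 1) = θ k := by
  have h1 : ¬ k + 1 < l := by omega
  have h2 : k + 1 ≠ l := by omega
  simp [insertAt, h1, h2]

lemma iterT_insert_le {T : Set Arc} {θ : ℕ → Option Arc} {l : ℕ} {δ : Arc} (k : ℕ)
    (h : k ≤ l) : iterT T (insertAt θ l δ) k = iterT T θ k := by
  induction k with
  | zero => rfl
  | succ k ih => rw [iterT, iterT, ih (by omega), insertAt_lt (by omega)]

lemma iterA_insert_le {T : Set Arc} {θ : ℕ → Option Arc} {l : ℕ} {δ γ : Arc} (k : ℕ)
    (h : k ≤ l) : iterA T (insertAt θ l δ) γ k = iterA T θ γ k := by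
  induction k with
  | zero => rfl
  | succ k ih =>
    rw [iterA, iterA, ih (by omega), insertAt_lt (by omega), iterT_insert_le k (by omega)]

/-- Exchanging the order of two independent replacements. -/
lemma swap_sets (S : Set Arc) {x x' d d' : Arc} (h1 : x ≠ d') (h2 : x' ≠ d) :
    (((S \ {d}) ∪ {d'}) \ {x}) ∪ {x'} = (((S \ {x}) ∪ {x'}) \ {d}) ∪ {d'} := by
  ext z
  simp only [Set.mem_union, Set.mem_sdiff, Set.mem_singleton_iff]
  grind

/-- The key commutation step. -/
lemma commute_step {S : Set Arc} (hS : IsTriangulation S) {d d' x : Arc}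
    (hd : d ∈ S) (hc : Cross d d') (hs : ∀ s, IsSide d d' s → s ∈ S)
    (hx : IsMutable S x) (hd1 : d ∈ mutate S x) (hs1 : ∀ s, IsSide d d' s → s ∈ mutate S x) :
    x ≠ d ∧ x ≠ d' ∧ flipArc S x ≠ d ∧ IsMutable ((S \ {d}) ∪ {d'}) x ∧
      flipArc ((S \ {d}) ∪ {d'}) x = flipArc S x ∧
      mutate ((S \ {d}) ∪ {d'}) x = (mutate S x \ {d}) ∪ {d'} := by
  have hE := hx.spec
  have hcx := hE.cross hS hx.1
  have hS1 : IsTriangulation (mutate S x) := hE.2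
  have hfm : flipArc S x ∈ mutate S x := Or.inr rfl
  have n1 : x ≠ d := by
    rintro rfl
    exact hS1.1 _ hd1 _ hfm hcx
  have n2 : x ≠ d' := by
    rintro rfl
    exact hS.1 _ hd _ hx.1 hc
  have n3 : flipArc S x ≠ d := by
    intro h
    rw [h] at hcx
    exact hS.1 _ hx.1 _ hd hcx
  have hS' := (mutExchange_of_sides hS hd hc hs).2
  have hS1' := (mutExchange_of_sides hS1 hd1 hc hs1).2
  have hxm : x ∈ (S \ {d}) ∪ {d'} := Or.inl ⟨hx.1, n1⟩
  have hsw := swap_sets S n2 n3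
  have hE' : MutExchange ((S \ {d}) ∪ {d'}) x (flipArc S x) := by
    refine ⟨hE.1, ?_⟩
    rw [hsw]
    exact hS1'
  have hf := flipArc_eq hS' hxm hE'
  refine ⟨n1, n2, n3, ⟨hxm, _, hE'⟩, hf, ?_⟩
  rw [mutate, hf, hsw]
  rfl

lemma insert_main (T : Set Arc) (hT : IsTriangulation T) (θ : ℕ → Option Arc)
    (hθ : Admissible T θ) (d d' : Arc) (hc : Cross d d') (l : ℕ) (hv : ValidPos θ l)
    (hd : ∀ k, l ≤ k → d ∈ iterT T θ k)
    (hs : ∀ k, l ≤ k → ∀ s, IsSide d d' s → s ∈ iterT T θ k) :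
    Admissible T (insertAt θ l d) ∧
      ∀ γ ∈ T, seqLimit T (insertAt θ l d) γ =
        if seqLimit T θ γ = d then d' else seqLimit T θ γ := by
  have hTk := iterT_tri hT hθ.2.1
  have hEl := mutExchange_of_sides (hTk l) (hd l le_rfl) hc (hs l le_rfl)
  have hfl := flipArc_eq (hTk l) (hd l le_rfl) hEl
  have step : ∀ k, l ≤ k → ∀ x, θ k = some x → _ := fun k hk x hx =>
    commute_step (hTk k) (hd k hk) hc (hs k hk) (hθ.2.1 k x hx)
      (by simpa [iterT, hx, stepT] using hd (k + 1) (by omega))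
      (by simpa [iterT, hx, stepT] using hs (k + 1) (by omega))
  have hT' : ∀ k, l ≤ k → iterT T (insertAt θ l d) (k + 1) = (iterT T θ k \ {d}) ∪ {d'} := by
    intro k hk
    induction k, hk using Nat.le_induction with
    | base =>
      rw [iterT, iterT_insert_le l le_rfl, insertAt_self]
      simp only [stepT, mutate, hfl]
    | succ k hk ih =>
      rw [iterT, ih, insertAt_succ hk, iterT]
      cases hx : θ k with
      | none => rfl
      | some x => exact (step k hk x hx).2.2.2.2.2
  have hA' : ∀ γ k, l ≤ k → iterA T (insertAt θ l d) γ (k + 1) =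
      if iterA T θ γ k = d then d' else iterA T θ γ k := by
    intro γ k hk
    induction k, hk using Nat.le_induction with
    | base =>
      rw [iterA, iterT_insert_le l le_rfl, iterA_insert_le l le_rfl, insertAt_self]
      simp only [stepA, mutArc, hfl]
    | succ k hk ih =>
      rw [iterA, ih, insertAt_succ hk, iterA, hT' k hk]
      cases hx : θ k with
      | none => rfl
      | some x =>
        obtain ⟨n1, n2, n3, -, hf, -⟩ := step k hk x hx
        simp only [stepA, mutArc, hf]
        by_cases h1 : iterA T θ γ k = d
        · simp [h1, n1.symm, n2.symm]
        · by_cases h2 : iterA T θ γ k = x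
          · simp [h2, n1, n3]
          · simp [h1, h2]
  have hlim : ∀ γ ∈ T, ∃ m, ∀ k, m ≤ k → iterA T (insertAt θ l d) γ k =
      if seqLimit T θ γ = d then d' else seqLimit T θ γ := by
    intro γ hγ
    obtain ⟨m, hm⟩ := seqLimit_spec hθ hγ
    refine ⟨max l m + 1, fun k hk => ?_⟩
    obtain ⟨j, rfl⟩ : ∃ j, k = j + 1 := ⟨k - 1, by omega⟩
    rw [hA' γ j (by omega), hm j (by omega)]
  refine ⟨⟨?_, ?_, ?_⟩, ?_⟩
  · intro i hi
    rcases lt_trichotomy i l with h | h | h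
    · rw [insertAt_lt h] at hi
      have := hv i h
      simp [hi] at this
    · subst h
      simp [insertAt_self] at hi
    · obtain ⟨j, rfl⟩ : ∃ j, i = j + 1 := ⟨i - 1, by omega⟩
      rw [insertAt_succ (by omega)] at hi ⊢
      exact hθ.1 j hi
  · intro i x hi
    rcases lt_trichotomy i l with h | h | h
    · rw [insertAt_lt h] at hi
      rw [iterT_insert_le i h.le]
      exact hθ.2.1 i x hi
    · subst h
      rw [insertAt_self] at hi
      obtain rfl := Option.some.inj hi
      rw [iterT_insert_le i le_rfl]
      exact ⟨hd i le_rfl, _, hEl⟩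
    · obtain ⟨j, rfl⟩ : ∃ j, i = j + 1 := ⟨i - 1, by omega⟩
      rw [insertAt_succ (by omega)] at hi
      rw [hT' j (by omega)]
      exact (step j (by omega) x hi).2.2.2.1
  · intro γ hγ
    obtain ⟨m, hm⟩ := hlim γ hγ
    exact ⟨m, fun k hk => by rw [hm k hk, hm m le_rfl]⟩
  · intro γ hγ
    obtain ⟨m, hm⟩ := hlim γ hγ
    exact seqLimit_eq hm

/-- If `μ_θ(T)` is a triangulation and `δ` is mutable in it, then for every large enough
valid position `l`, the inserted sequence `θ ∪_l (δ)` is `T`-admissible and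
`μ_{θ∪_l(δ)}(γ) = μ_δ(μ_θ(γ))` for all `γ ∈ T`. -/
theorem statement9 (T : Set Arc) (hT : IsTriangulation T) (θ : ℕ → Option Arc)
    (hθ : Admissible T θ) (hTri : IsTriangulation (mutSeq T θ))
    (δ : Arc) (hδ : IsMutable (mutSeq T θ) δ) :
    ∃ r : ℕ, ValidPos θ r ∧ ∀ l : ℕ, r ≤ l → ValidPos θ l →
      Admissible T (insertAt θ l δ) ∧
      ∀ γ ∈ T, seqLimit T (insertAt θ l δ) γ = mutArc (mutSeq T θ) δ (seqLimit T θ γ) := by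
  have hE := hδ.spec
  have hc := hE.cross hTri hδ.1
  have hev : ∀ᶠ k in Filter.atTop, δ ∈ iterT T θ k ∧
      ∀ s ∈ {s | IsSide δ (flipArc (mutSeq T θ) δ) s}, s ∈ iterT T θ k := by
    refine (mem_eventually hθ hδ.1).and ?_
    rw [Filter.eventually_all_finite (side_finite _ _)]
    intro s hs
    exact mem_eventually hθ (hE.side_mem hTri hδ.1 hs)
  obtain ⟨R, hR⟩ := Filter.eventually_atTop.1 hev
  have hr : ∃ r, ValidPos θ r ∧ ∀ k, r ≤ k → (δ ∈ iterT T θ k ∧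
      ∀ s ∈ {s | IsSide δ (flipArc (mutSeq T θ) δ) s}, s ∈ iterT T θ k) := by
    by_cases hv : ∃ n, θ n = none
    · refine ⟨Nat.find hv, ?_, ?_⟩
      · intro k hk
        exact Option.isSome_iff_ne_none.2 (Nat.find_min hv hk)
      · intro k hk
        have hn := Nat.find_spec hv
        rw [iterT_const hθ.1 hn hk,
          ← iterT_const (T := T) hθ.1 hn (le_max_left (Nat.find hv) R)]
        exact hR _ (le_max_right _ _)
    · push Not at hv
      exact ⟨R, fun k _ => Option.isSome_iff_ne_none.2 (hv k), hR⟩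
  obtain ⟨r, hrv, hr⟩ := hr
  refine ⟨r, hrv, fun l hl hlv => ?_⟩
  exact insert_main T hT θ hθ δ _ hc l hlv (fun k hk => (hr k (hl.trans hk)).1)
    (fun k hk => (hr k (hl.trans hk)).2)
end

section
/- The relation ≤_s is a preorder on the set of triangulations of the ∞-gon: it is reflexive, and if T ≤_s T′ and T′ ≤_s T″ then T ≤_s T″. -/
open scoped Classical

/-- An arc of the ∞-gon: a pair of integers `(i,j)` with `i ≤ j − 2`. -/
structure ArcZ where
  src : ℤ
  tgt : ℤ
  sep : src + 2 ≤ tgt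

/-- Two arcs `(i,j)` and `(k,l)` cross if `i < k < j < l` or `k < i < l < j`. -/
def CrossZ (x y : ArcZ) : Prop :=
  (x.src < y.src ∧ y.src < x.tgt ∧ x.tgt < y.tgt) ∨
  (y.src < x.src ∧ x.src < y.tgt ∧ y.tgt < x.tgt)

/-- A triangulation of the ∞-gon: a maximal set of pairwise compatible
(= non-crossing) arcs. -/
def IsTriangulationZ (T : Set ArcZ) : Prop :=
  (∀ x ∈ T, ∀ y ∈ T, ¬ CrossZ x y) ∧
  ∀ γ : ArcZ, (∀ x ∈ T, ¬ CrossZ γ x) → γ ∈ T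

/-- `T` has a right fountain at `n`. -/
def RightFountainZ (T : Set ArcZ) (n : ℤ) : Prop :=
  {p : ℤ | ∃ γ ∈ T, γ.src = n ∧ γ.tgt = p}.Infinite

/-- `T` has a left fountain at `n`. -/
def LeftFountainZ (T : Set ArcZ) (n : ℤ) : Prop :=
  {p : ℤ | ∃ γ ∈ T, γ.src = p ∧ γ.tgt = n}.Infinite

/-- `T` is locally finite if every integer is an endpoint of only finitely many arcs of `T`. -/
def LocallyFinZ (T : Set ArcZ) : Prop :=
  ∀ v : ℤ, {γ | γ ∈ T ∧ (γ.src = v ∨ γ.tgt = v)}.Finite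

/-- `γ'` is an exchange partner for `γ` relative to `T`:
it is distinct from `γ` and `(T \ {γ}) ∪ {γ'}` is again a triangulation. -/
def MutExchangeZ (T : Set ArcZ) (γ γ' : ArcZ) : Prop :=
  γ' ≠ γ ∧ IsTriangulationZ ((T \ {γ}) ∪ {γ'})

/-- `γ` is a mutable arc of `T`. -/
def IsMutableZ (T : Set ArcZ) (γ : ArcZ) : Prop :=
  γ ∈ T ∧ ∃ γ', MutExchangeZ T γ γ'

/-- The (unique) replacement arc of `γ` in `T`, when `γ` is mutable. -/
noncomputable def flipArcZ (T : Set ArcZ) (γ : ArcZ) : ArcZ :=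
  if h : ∃ γ', MutExchangeZ T γ γ' then h.choose else γ

/-- The mutation `μ_γ(T)` of `T` at `γ`. -/
noncomputable def mutateZ (T : Set ArcZ) (γ : ArcZ) : Set ArcZ :=
  (T \ {γ}) ∪ {flipArcZ T γ}

/-- `μ_γ(δ)`: the effect of the mutation of `T` at `γ` on the arc `δ`. -/
noncomputable def mutArcZ (T : Set ArcZ) (γ δ : ArcZ) : ArcZ :=
  if δ = γ then flipArcZ T γ else δ

/-- One step of a mutation sequence on a set of arcs (`none` = no entry). -/
noncomputable def stepTZ (T : Set ArcZ) : Option ArcZ → Set ArcZ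
  | none => T
  | some γ => mutateZ T γ

/-- One step of a mutation sequence on a single arc. -/
noncomputable def stepAZ (T : Set ArcZ) : Option ArcZ → ArcZ → ArcZ
  | none, δ => δ
  | some γ, δ => mutArcZ T γ δ

/-- `iterTZ T θ k` is `μ_{θ_k} ∘ ⋯ ∘ μ_{θ_1}(T)`. Sequences (finite or infinite) are
encoded as `θ : ℕ → Option ArcZ` whose support is downward closed. -/
noncomputable def iterTZ (T : Set ArcZ) (θ : ℕ → Option ArcZ) : ℕ → Set ArcZ
  | 0 => T
  | k + 1 => stepTZ (iterTZ T θ k) (θ k)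

/-- `iterAZ T θ γ k` is `μ_{θ_k} ∘ ⋯ ∘ μ_{θ_1}(γ)`. -/
noncomputable def iterAZ (T : Set ArcZ) (θ : ℕ → Option ArcZ) (γ : ArcZ) : ℕ → ArcZ
  | 0 => γ
  | k + 1 => stepAZ (iterTZ T θ k) (θ k) (iterAZ T θ γ k)

/-- `θ` is a `T`-admissible sequence: its support is downward closed (so it is a genuine
finite or infinite sequence), each entry is mutable in the triangulation obtained by the
previous mutations, and the mutation of each arc of `T` along `θ` eventually stabilizes. -/
def AdmissibleZ (T : Set ArcZ) (θ : ℕ → Option ArcZ) : Prop :=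
  (∀ i, θ i = none → θ (i + 1) = none) ∧
  (∀ i γ, θ i = some γ → IsMutableZ (iterTZ T θ i) γ) ∧
  (∀ γ ∈ T, ∃ l, ∀ k, l ≤ k → iterAZ T θ γ k = iterAZ T θ γ l)

/-- `μ_θ(γ)`: the stable value of the mutation of the arc `γ` along the sequence `θ`. -/
noncomputable def seqLimitZ (T : Set ArcZ) (θ : ℕ → Option ArcZ) (γ : ArcZ) : ArcZ :=
  if h : ∃ l, ∀ k, l ≤ k → iterAZ T θ γ k = iterAZ T θ γ l
  then iterAZ T θ γ h.choose else γ

/-- `μ_θ(T)`: the mutation of `T` along the sequence `θ`. -/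
noncomputable def mutSeqZ (T : Set ArcZ) (θ : ℕ → Option ArcZ) : Set ArcZ :=
  seqLimitZ T θ '' T

/-- The sequence `θ` leaves the arc `γ` untouched. -/
def UntouchedZ (T : Set ArcZ) (θ : ℕ → Option ArcZ) (γ : ArcZ) : Prop :=
  ∀ l, iterAZ T θ γ l = γ

/-- The quadrilateral `S(γ)` of a mutable arc `γ` in `T`: with `v₁ < v₂ < v₃ < v₄` the four
endpoints of the two diagonals `γ` and `flipArcZ T γ`, it consists of those of the pairs
`(v₁,v₂), (v₂,v₃), (v₃,v₄), (v₁,v₄)` that are arcs. -/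
noncomputable def quadZ (T : Set ArcZ) (γ : ArcZ) : Set ArcZ :=
  let γ' := flipArcZ T γ
  let vs : ℤ × ℤ × ℤ × ℤ :=
    if γ.src < γ'.src then (γ.src, γ'.src, γ.tgt, γ'.tgt) else (γ'.src, γ.src, γ'.tgt, γ.tgt)
  {δ : ArcZ | (δ.src = vs.1 ∧ δ.tgt = vs.2.1) ∨ (δ.src = vs.2.1 ∧ δ.tgt = vs.2.2.1) ∨
    (δ.src = vs.2.2.1 ∧ δ.tgt = vs.2.2.2) ∨ (δ.src = vs.1 ∧ δ.tgt = vs.2.2.2)}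

/-- The restriction `T|_S` of a set of arcs to a set `S` of vertices. -/
def restrictZ (T : Set ArcZ) (S : Set ℤ) : Set ArcZ :=
  {γ | γ ∈ T ∧ γ.src ∈ S ∧ γ.tgt ∈ S}

/-- `T ≤_s T'`: there is a `T`-admissible sequence `θ` with `μ_θ(T) = T'`. -/
def leS (T T' : Set ArcZ) : Prop :=
  ∃ θ : ℕ → Option ArcZ, AdmissibleZ T θ ∧ mutSeqZ T θ = T'

/-- Crossing of integer pairs. -/
def CrI (a b c d : ℤ) : Prop := (a < c ∧ c < b ∧ b < d) ∨ (c < a ∧ a < d ∧ d < b)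

theorem arc_ext {x y : ArcZ} (h1 : x.src = y.src) (h2 : x.tgt = y.tgt) : x = y := by
  cases x; cases y; simp_all

theorem cross_symm {x y : ArcZ} (h : CrossZ x y) : CrossZ y x := by
  unfold CrossZ at *; omega

/-- The (up to four) sides of the quadrilateral with diagonals `x`, `y`. -/
def sides (x y : ArcZ) : Set ArcZ :=
  {δ | (δ.src = min x.src y.src ∧ δ.tgt = max x.src y.src) ∨
    (δ.src = max x.src y.src ∧ δ.tgt = min x.tgt y.tgt) ∨
    (δ.src = min x.tgt y.tgt ∧ δ.tgt = max x.tgt y.tgt) ∨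
    (δ.src = min x.src y.src ∧ δ.tgt = max x.tgt y.tgt)}

theorem sides_comm (x y : ArcZ) : sides x y = sides y x := by
  unfold sides; simp only [min_comm, max_comm]

theorem sides_finite (x y : ArcZ) : (sides x y).Finite := by
  have hinj : Function.Injective (fun δ : ArcZ => (δ.src, δ.tgt)) := by
    intro a b h
    simp only [Prod.mk.injEq] at h
    exact arc_ext h.1 h.2
  apply Set.Finite.of_finite_image _ hinj.injOn
  apply Set.Finite.subset (s := {(min x.src y.src, max x.src y.src),
    (max x.src y.src, min x.tgt y.tgt), (min x.tgt y.tgt, max x.tgt y.tgt),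
    (min x.src y.src, max x.tgt y.tgt)}) (Set.toFinite _)
  rintro _ ⟨δ, hδ, rfl⟩
  simpa [sides] using hδ

theorem num_cross (a b c d p q : ℤ) (h1 : a < b) (h2 : b < c) (h3 : c < d) (hpq : p + 2 ≤ q)
    (s1 : ¬ CrI p q a b) (s2 : ¬ CrI p q b c) (s3 : ¬ CrI p q c d) (s4 : ¬ CrI p q a d)
    : (CrI p q b d → p = a ∧ q = c) ∧ (CrI p q a c → p = b ∧ q = d) := by
  unfold CrI at *
  constructor <;> intro h <;> omega

/-- An arc crossing one diagonal but no side is the other diagonal. -/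
theorem quad_cross_aux {x y z : ArcZ} (hxy : CrossZ x y) (hlt : x.src < y.src)
    (hs : ∀ w ∈ sides x y, ¬ CrossZ z w) :
    (CrossZ z y → z = x) ∧ (CrossZ z x → z = y) := by
  have h2 : y.src < x.tgt ∧ x.tgt < y.tgt := by unfold CrossZ at hxy; omega
  have key : ∀ a b : ℤ, ((a = x.src ∧ b = y.src) ∨ (a = y.src ∧ b = x.tgt) ∨
      (a = x.tgt ∧ b = y.tgt) ∨ (a = x.src ∧ b = y.tgt)) → ¬ CrI z.src z.tgt a b := by
    intro a b hab hc
    by_cases hsep : a + 2 ≤ b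
    · refine hs ⟨a, b, hsep⟩ ?_ hc
      simp only [sides, Set.mem_ofPred_eq]
      rw [min_eq_left hlt.le, max_eq_right hlt.le, min_eq_left h2.2.le, max_eq_right h2.2.le]
      exact hab
    · have := z.sep
      unfold CrI at hc
      omega
  have := num_cross x.src y.src x.tgt y.tgt z.src z.tgt hlt h2.1 h2.2 z.sep
    (key _ _ (by simp)) (key _ _ (by simp)) (key _ _ (by simp)) (key _ _ (by simp))
  exact ⟨fun h => arc_ext (this.1 h).1 (this.1 h).2, fun h => arc_ext (this.2 h).1 (this.2 h).2⟩

theorem quad_cross {x y z : ArcZ} (hxy : CrossZ x y)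
    (hs : ∀ w ∈ sides x y, ¬ CrossZ z w) :
    (CrossZ z y → z = x) ∧ (CrossZ z x → z = y) := by
  by_cases hlt : x.src < y.src
  · exact quad_cross_aux hxy hlt hs
  · have hlt' : y.src < x.src := by unfold CrossZ at hxy; omega
    rw [sides_comm] at hs
    exact (quad_cross_aux (cross_symm hxy) hlt' hs).symm

/-- What crosses a side crosses a diagonal. -/
theorem side_cross {x y z w : ArcZ} (hxy : CrossZ x y) (hw : w ∈ sides x y) (h : CrossZ w z) :
    CrossZ x z ∨ CrossZ y z := by
  simp only [sides, Set.mem_ofPred_eq] at hw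
  unfold CrossZ at *
  have := x.sep; have := y.sep; have := z.sep; have := w.sep
  omega

theorem side_not_cross {x y w : ArcZ} (hxy : CrossZ x y) (hw : w ∈ sides x y) :
    ¬ CrossZ w x ∧ ¬ CrossZ w y := by
  simp only [sides, Set.mem_ofPred_eq] at hw
  unfold CrossZ at *
  have := x.sep; have := y.sep; have := w.sep
  omega

theorem exch_facts {T : Set ArcZ} (hT : IsTriangulationZ T) {γ γ' : ArcZ} (hγ : γ ∈ T)
    (h : MutExchangeZ T γ γ') : γ' ∉ T ∧ CrossZ γ γ' ∧ sides γ γ' ⊆ T \ {γ} := by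
  obtain ⟨hne, hT'⟩ := h
  have hself : ∀ x : ArcZ, ¬ CrossZ x x := by intro x; unfold CrossZ; omega
  have h1 : γ' ∉ T := by
    intro hm
    have : γ ∈ (T \ {γ}) ∪ {γ'} := by
      apply hT'.2
      rintro x (hx | hx)
      · exact hT.1 _ hγ _ hx.1
      · rw [Set.mem_singleton_iff] at hx
        subst hx; exact hT.1 _ hγ _ hm
    rcases this with h | h
    · exact h.2 rfl
    · exact hne h.symm
  have h2 : CrossZ γ γ' := by
    by_contra hc
    apply h1
    apply hT.2
    intro x hx
    by_cases hxγ : x = γ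
    · subst hxγ; exact fun h => hc (cross_symm h)
    · exact hT'.1 _ (Or.inr rfl) _ (Or.inl ⟨hx, hxγ⟩)
  refine ⟨h1, h2, ?_⟩
  intro w hw
  have hw' := side_not_cross h2 hw
  constructor
  · apply hT.2
    intro z hz hc
    by_cases hzγ : z = γ
    · subst hzγ; exact hw'.1 hc
    · rcases side_cross h2 hw hc with h | h
      · exact hT.1 _ hγ _ hz h
      · exact hT'.1 _ (Or.inr rfl) _ (Or.inl ⟨hz, hzγ⟩) h
  · intro hwγ
    rw [Set.mem_singleton_iff] at hwγ
    subst hwγ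
    exact hw'.2 h2

theorem exch_unique {T : Set ArcZ} (hT : IsTriangulationZ T) {γ γ' γ'' : ArcZ} (hγ : γ ∈ T)
    (h : MutExchangeZ T γ γ') (h' : MutExchangeZ T γ γ'') : γ'' = γ' := by
  obtain ⟨_, h2, h3⟩ := exch_facts hT hγ h
  obtain ⟨_, k2, _⟩ := exch_facts hT hγ h'
  refine (quad_cross h2 ?_).2 (cross_symm k2)
  intro w hw
  exact h'.2.1 _ (Or.inr rfl) _ (Or.inl (h3 hw))

theorem flip_exch {T : Set ArcZ} {γ : ArcZ} (h : IsMutableZ T γ) :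
    MutExchangeZ T γ (flipArcZ T γ) := by
  unfold flipArcZ
  rw [dif_pos h.2]
  exact h.2.choose_spec

theorem flip_eq {T : Set ArcZ} (hT : IsTriangulationZ T) {γ γ' : ArcZ} (hγ : γ ∈ T)
    (h : MutExchangeZ T γ γ') : flipArcZ T γ = γ' :=
  exch_unique hT hγ h (flip_exch ⟨hγ, _, h⟩)

/-- Locality of the exchange. -/
theorem exch_local {S : Set ArcZ} (hS : IsTriangulationZ S) {γ γ' : ArcZ} (hγ : γ ∈ S)
    (hc : CrossZ γ γ') (hs : sides γ γ' ⊆ S) :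
    MutExchangeZ S γ γ' ∧ γ' ∉ S := by
  have hself : ∀ x : ArcZ, ¬ CrossZ x x := by intro x; unfold CrossZ; omega
  have key : ∀ x ∈ S \ {γ}, ¬ CrossZ x γ' := by
    intro x hx h
    exact hx.2 ((quad_cross hc (fun w hw => hS.1 _ hx.1 _ (hs hw))).1 h)
  refine ⟨⟨?_, ?_, ?_⟩, fun h => hS.1 _ hγ _ h hc⟩
  · rintro rfl; exact hself _ hc
  · rintro x (hx | hx) y (hy | hy) h
    · exact hS.1 _ hx.1 _ hy.1 h
    · rw [Set.mem_singleton_iff] at hy; subst hy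
      exact key x hx h
    · rw [Set.mem_singleton_iff] at hx; subst hx
      exact key y hy (cross_symm h)
    · rw [Set.mem_singleton_iff] at hx hy; subst hx; subst hy
      exact hself _ h
  · intro δ hδ
    by_cases hcδ : CrossZ δ γ
    · right
      refine (quad_cross hc ?_).2 hcδ
      intro w hw
      refine hδ w (Or.inl ⟨hs hw, ?_⟩)
      intro hwγ
      rw [Set.mem_singleton_iff] at hwγ
      subst hwγ
      exact (side_not_cross hc hw).2 hc
    · left
      constructor
      · apply hS.2
        intro x hx
        by_cases hxγ : x = γ
        · subst hxγ; exact hcδ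
        · exact hδ _ (Or.inl ⟨hx, hxγ⟩)
      · intro h
        rw [Set.mem_singleton_iff] at h
        subst h
        exact hδ γ' (Or.inr rfl) hc

/-- A labelled triangulation. -/
def Lab (T : Set ArcZ) (f : ArcZ → ArcZ) : Prop :=
  Set.InjOn f T ∧ IsTriangulationZ (f '' T)

theorem image_update {T : Set ArcZ} {f f' : ArcZ → ArcZ} (hf : Set.InjOn f T) {t : ArcZ}
    (ht : t ∈ T) (hoff : ∀ s ∈ T, s ≠ t → f' s = f s) :
    f' '' T = (f '' T \ {f t}) ∪ {f' t} := by
  ext x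
  constructor
  · rintro ⟨s, hs, rfl⟩
    by_cases h : s = t
    · subst h; exact Or.inr rfl
    · left
      rw [hoff s hs h]
      exact ⟨⟨s, hs, rfl⟩, fun h' => h (hf hs ht h')⟩
  · rintro (⟨⟨s, hs, rfl⟩, hx⟩ | hx)
    · have : s ≠ t := by rintro rfl; exact hx rfl
      exact ⟨s, hs, hoff s hs this⟩
    · exact ⟨t, ht, hx.symm⟩

theorem lab_update {T : Set ArcZ} {f f' : ArcZ → ArcZ} (hf : Lab T f) {t : ArcZ}
    (ht : t ∈ T) (hoff : ∀ s ∈ T, s ≠ t → f' s = f s)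
    (hex : MutExchangeZ (f '' T) (f t) (f' t)) : Lab T f' := by
  have hn := (exch_facts hf.2 ⟨t, ht, rfl⟩ hex).1
  constructor
  · intro a ha b hb hab
    by_cases h1 : a = t <;> by_cases h2 : b = t
    · rw [h1, h2]
    · exfalso; subst h1; rw [hoff b hb h2] at hab; exact hn ⟨b, hb, hab.symm⟩
    · exfalso; subst h2; rw [hoff a ha h1] at hab; exact hn ⟨a, ha, hab⟩
    · rw [hoff a ha h1, hoff b hb h2] at hab; exact hf.1 ha hb hab
  · rw [image_update hf.1 ht hoff]; exact hex.2

/-- Mutation sequences yield labelled triangulations. -/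
theorem iter_lab {T : Set ArcZ} (hT : IsTriangulationZ T) {θ : ℕ → Option ArcZ}
    (hθ : AdmissibleZ T θ) (k : ℕ) :
    Lab T (fun t => iterAZ T θ t k) ∧ (fun t => iterAZ T θ t k) '' T = iterTZ T θ k := by
  induction k with
  | zero =>
    simp only [iterAZ, iterTZ, Set.image_id']
    refine ⟨⟨fun a _ b _ h => h, ?_⟩, trivial⟩
    simpa using hT
  | succ k ih =>
    obtain ⟨hl, him⟩ := ih
    cases hk : θ k with
    | none =>
      simp only [iterAZ, iterTZ, hk, stepAZ, stepTZ]
      exact ⟨hl, him⟩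
    | some γ =>
      have hm := hθ.2.1 k γ hk
      have hγ := hm.1
      rw [← him] at hγ
      obtain ⟨t, ht, htγ⟩ := hγ
      simp only at htγ
      have hoff : ∀ s ∈ T, s ≠ t → iterAZ T θ s (k+1) = iterAZ T θ s k := by
        intro s hs hst
        simp only [iterAZ, hk, stepAZ, mutArcZ]
        rw [if_neg]
        intro h
        exact hst (hl.1 hs ht (h.trans htγ.symm))
      have hat : iterAZ T θ t (k+1) = flipArcZ (iterTZ T θ k) γ := by
        simp only [iterAZ, hk, stepAZ, mutArcZ]
        rw [if_pos htγ]
      constructor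
      · apply lab_update hl ht hoff
        rw [him, htγ, hat]
        exact flip_exch hm
      · rw [image_update hl.1 ht hoff]
        rw [him, htγ, hat]
        simp only [iterTZ, hk, stepTZ, mutateZ]

theorem iter_diff {T : Set ArcZ} (hT : IsTriangulationZ T) {θ : ℕ → Option ArcZ}
    (hθ : AdmissibleZ T θ) (k : ℕ) {s t : ArcZ} (hs : s ∈ T) (ht : t ∈ T)
    (h1 : iterAZ T θ s (k+1) ≠ iterAZ T θ s k) (h2 : iterAZ T θ t (k+1) ≠ iterAZ T θ t k) :
    s = t := by
  have hl := (iter_lab hT hθ k).1.1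
  cases hk : θ k with
  | none => exact absurd (by simp [iterAZ, hk, stepAZ]) h1
  | some γ =>
    simp only [iterAZ, hk, stepAZ, mutArcZ] at h1 h2
    have e1 : iterAZ T θ s k = γ := by
      by_contra h; rw [if_neg h] at h1; exact h1 rfl
    have e2 : iterAZ T θ t k = γ := by
      by_contra h; rw [if_neg h] at h2; exact h2 rfl
    exact hl hs ht (e1.trans e2.symm)

theorem limit_spec {T : Set ArcZ} {θ : ℕ → Option ArcZ} {t : ArcZ}
    (h : ∃ l, ∀ k, l ≤ k → iterAZ T θ t k = iterAZ T θ t l) :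
    ∃ l, ∀ k, l ≤ k → iterAZ T θ t k = seqLimitZ T θ t := by
  unfold seqLimitZ
  rw [dif_pos h]
  exact ⟨_, h.choose_spec⟩

theorem limit_eq {T : Set ArcZ} {θ : ℕ → Option ArcZ} {t x : ArcZ}
    (h : ∃ l, ∀ k, l ≤ k → iterAZ T θ t k = x) : seqLimitZ T θ t = x := by
  obtain ⟨l, hl⟩ := h
  obtain ⟨l', hl'⟩ := limit_spec (T := T) (θ := θ) (t := t)
    ⟨l, fun k hk => by rw [hl k hk, hl l le_rfl]⟩
  rw [← hl (max l l') (le_max_left _ _), hl' _ (le_max_right _ _)]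

theorem limit_inj {T : Set ArcZ} (hT : IsTriangulationZ T) {θ : ℕ → Option ArcZ}
    (hθ : AdmissibleZ T θ) : Set.InjOn (seqLimitZ T θ) T := by
  intro a ha b hb hab
  obtain ⟨l, hl⟩ := limit_spec (hθ.2.2 a ha)
  obtain ⟨l', hl'⟩ := limit_spec (hθ.2.2 b hb)
  apply (iter_lab hT hθ (max l l')).1.1 ha hb
  simp only
  rw [hl _ (le_max_left _ _), hl' _ (le_max_right _ _), hab]

/-- A sequence of labelled triangulations without idle steps (except at the end). -/
theorem leS_of_strict {T : Set ArcZ} (H : ℕ → ArcZ → ArcZ) (g : ArcZ → ArcZ)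
    (h0 : ∀ t ∈ T, H 0 t = t) (hlab : ∀ n, Lab T (H n))
    (hdiff : ∀ n, ∀ s ∈ T, ∀ t ∈ T, H (n+1) s ≠ H n s → H (n+1) t ≠ H n t → s = t)
    (hend : ∀ n, (∀ t ∈ T, H (n+1) t = H n t) → (∀ t ∈ T, H (n+2) t = H (n+1) t))
    (hlim : ∀ t ∈ T, ∃ l, ∀ n, l ≤ n → H n t = g t) : leS T (g '' T) := by
  let θ : ℕ → Option ArcZ := fun n =>
    if h : ∃ t ∈ T, H (n+1) t ≠ H n t then some (H n h.choose) else none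
  have hnone : ∀ n, θ n = none ↔ ∀ t ∈ T, H (n+1) t = H n t := by
    intro n
    simp only [θ]
    split_ifs with h
    · simp only [false_iff, reduceCtorEq]
      obtain ⟨t, ht, hh⟩ := h
      exact fun h' => hh (h' t ht)
    · push Not at h
      simpa using h
  have hsome : ∀ n γ, θ n = some γ → ∃ t ∈ T, H (n+1) t ≠ H n t ∧ γ = H n t := by
    intro n γ hγ
    simp only [θ] at hγ
    split_ifs at hγ with h
    · exact ⟨h.choose, h.choose_spec.1, h.choose_spec.2, by simpa using hγ.symm⟩
  have hex : ∀ n, ∀ t ∈ T, H (n+1) t ≠ H n t →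
      (∀ s ∈ T, s ≠ t → H (n+1) s = H n s) ∧ MutExchangeZ (H n '' T) (H n t) (H (n+1) t) := by
    intro n t ht hne
    have hoff : ∀ s ∈ T, s ≠ t → H (n+1) s = H n s := by
      intro s hs hst
      by_contra h
      exact hst (hdiff n s hs t ht h hne)
    refine ⟨hoff, hne, ?_⟩
    rw [← image_update (hlab n).1 ht hoff]
    exact (hlab (n+1)).2
  have hit : ∀ n, iterTZ T θ n = H n '' T ∧ ∀ t ∈ T, iterAZ T θ t n = H n t := by
    intro n
    induction n with
    | zero =>
      refine ⟨?_, fun t ht => (h0 t ht).symm⟩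
      simp only [iterTZ]
      rw [Set.image_congr h0]; simp
    | succ n ih =>
      cases hk : θ n with
      | none =>
        have he := (hnone n).1 hk
        simp only [iterTZ, iterAZ, hk, stepTZ, stepAZ]
        refine ⟨?_, fun t ht => by rw [ih.2 t ht, he t ht]⟩
        rw [ih.1]; exact (Set.image_congr he).symm
      | some γ =>
        obtain ⟨t, ht, hne, rfl⟩ := hsome n γ hk
        obtain ⟨hoff, hx⟩ := hex n t ht hne
        have hfl := flip_eq (hlab n).2 ⟨t, ht, rfl⟩ hx
        simp only [iterTZ, iterAZ, hk, stepTZ, stepAZ, mutateZ, mutArcZ, ih.1, hfl]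
        refine ⟨(image_update (hlab n).1 ht hoff).symm, ?_⟩
        intro s hs
        rw [ih.2 s hs]
        by_cases hst : s = t
        · subst hst; simp
        · rw [if_neg (fun h => hst ((hlab n).1 hs ht h)), hoff s hs hst]
  have hlim' : ∀ t ∈ T, ∃ l, ∀ n, l ≤ n → iterAZ T θ t n = g t := by
    intro t ht
    obtain ⟨l, hl⟩ := hlim t ht
    exact ⟨l, fun n hn => by rw [(hit n).2 t ht, hl n hn]⟩
  refine ⟨θ, ⟨?_, ?_, ?_⟩, ?_⟩
  · intro i hi
    rw [hnone] at hi ⊢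
    exact hend i hi
  · intro n γ hγ
    obtain ⟨t, ht, hne, rfl⟩ := hsome n γ hγ
    rw [(hit n).1]
    exact ⟨⟨t, ht, rfl⟩, _, (hex n t ht hne).2⟩
  · intro t ht
    obtain ⟨l, hl⟩ := hlim' t ht
    exact ⟨l, fun k hk => by rw [hl k hk, hl l le_rfl]⟩
  · unfold mutSeqZ
    exact Set.image_congr (fun t ht => limit_eq (hlim' t ht))

/-- Idle steps can be removed. -/
theorem leS_of_weak {T : Set ArcZ} (G : ℕ → ArcZ → ArcZ) (g : ArcZ → ArcZ)
    (h0 : ∀ t ∈ T, G 0 t = t) (hlab : ∀ n, Lab T (G n))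
    (hdiff : ∀ n, ∀ s ∈ T, ∀ t ∈ T, G (n+1) s ≠ G n s → G (n+1) t ≠ G n t → s = t)
    (hlim : ∀ t ∈ T, ∃ l, ∀ n, l ≤ n → G n t = g t) : leS T (g '' T) := by
  let act : ℕ → ℕ → Prop := fun n m => n ≤ m ∧ ∃ t ∈ T, G (m+1) t ≠ G m t
  let nx : ℕ → ℕ := fun n => if h : ∃ m, act n m then Nat.find h + 1 else n
  let pos : ℕ → ℕ := fun m => Nat.rec 0 (fun _ p => nx p) m
  have pos_succ : ∀ m, pos (m+1) = nx (pos m) := fun m => rfl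
  have const : ∀ n m, n ≤ m → (∀ i, n ≤ i → i < m → ∀ t ∈ T, G (i+1) t = G i t) →
      ∀ t ∈ T, G m t = G n t := by
    intro n m hnm
    induction m, hnm using Nat.le_induction with
    | base => intro _ t _; rfl
    | succ m hm ih =>
      intro h t ht
      rw [h m hm (Nat.lt_succ_self m) t ht]
      exact ih (fun i hi him => h i hi (by omega)) t ht
  have nx_pos : ∀ n, (∃ m, act n m) → ∃ m, nx n = m + 1 ∧ n ≤ m ∧
      (∀ t ∈ T, G m t = G n t) ∧ ∃ t ∈ T, G (m+1) t ≠ G m t := by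
    intro n h
    refine ⟨Nat.find h, dif_pos h, (Nat.find_spec h).1, ?_, (Nat.find_spec h).2⟩
    apply const n _ (Nat.find_spec h).1
    intro i hi him t ht
    by_contra hc
    exact Nat.find_min h him ⟨hi, t, ht, hc⟩
  have nx_neg : ∀ n, (¬ ∃ m, act n m) → nx n = n := fun n h => dif_neg h
  have hA : ∀ m, m ≤ pos m ∨ ¬ ∃ m', act (pos m) m' := by
    intro m
    induction m with
    | zero => left; exact Nat.zero_le _
    | succ m ih =>
      rw [pos_succ]
      rcases Classical.em (∃ m', act (pos m) m') with h | h
      · left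
        obtain ⟨m', h1, h2, _⟩ := nx_pos _ h
        rcases ih with ih | ih
        · omega
        · exact absurd h ih
      · right; rw [nx_neg _ h]; exact h
  apply leS_of_strict (fun m => G (pos m)) g
  · exact h0
  · exact fun n => hlab _
  · intro n s hs t ht h1 h2
    simp only [pos_succ] at h1 h2
    rcases Classical.em (∃ m', act (pos n) m') with h | h
    · obtain ⟨m', e, _, hc, _⟩ := nx_pos _ h
      rw [e, ← hc s hs] at h1
      rw [e, ← hc t ht] at h2
      exact hdiff m' s hs t ht h1 h2
    · rw [nx_neg _ h] at h1; exact absurd rfl h1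
  · intro n hn t ht
    simp only [pos_succ] at hn
    have hneg : ¬ ∃ m', act (pos n) m' := by
      intro h
      obtain ⟨m', e, _, hc, s, hs, hne⟩ := nx_pos _ h
      have := hn s hs
      rw [e, ← hc s hs] at this
      exact hne this
    have e1 : pos (n+1) = pos n := by rw [pos_succ, nx_neg _ hneg]
    have e2 : pos (n+2) = pos (n+1) := by rw [pos_succ (n+1), e1, nx_neg _ hneg]
    simp only [e2]
  · intro t ht
    obtain ⟨l, hl⟩ := hlim t ht
    refine ⟨l, fun m hm => ?_⟩
    rcases hA m with h | h
    · exact hl _ (hm.trans h)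
    · have := const (pos m) (max (pos m) l) (le_max_left _ _) (fun i hi _ s hs => by
        by_contra hc
        exact h ⟨i, hi, s, hs, hc⟩) t ht
      rw [← this, hl _ (le_max_right _ _)]

/-- The two-parameter family. -/
noncomputable def FF (T T' : Set ArcZ) (θ θ' : ℕ → Option ArcZ) (k : ℕ) : ℕ → ArcZ → ArcZ
  | 0, t => iterAZ T θ t k
  | j + 1, t => if θ' j = some (iterAZ T' θ' (seqLimitZ T θ t) j)
      then iterAZ T' θ' (seqLimitZ T θ t) (j + 1) else FF T T' θ θ' k j t

theorem psi_step {T' : Set ArcZ} {θ' : ℕ → Option ArcZ} {u : ArcZ} {j : ℕ}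
    (h : θ' j ≠ some (iterAZ T' θ' u j)) : iterAZ T' θ' u (j+1) = iterAZ T' θ' u j := by
  cases hk : θ' j with
  | none => simp [iterAZ, hk, stepAZ]
  | some γ =>
    simp only [iterAZ, hk, stepAZ, mutArcZ]
    rw [if_neg]
    rintro rfl
    exact h hk

theorem FF_dich (T T' : Set ArcZ) (θ θ' : ℕ → Option ArcZ) (j : ℕ) (t : ArcZ) :
    ((∀ k, FF T T' θ θ' k j t = iterAZ T θ t k) ∧
      iterAZ T' θ' (seqLimitZ T θ t) j = seqLimitZ T θ t) ∨
    (∀ k, FF T T' θ θ' k j t = iterAZ T' θ' (seqLimitZ T θ t) j) := by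
  induction j with
  | zero => left; exact ⟨fun k => rfl, rfl⟩
  | succ j ih =>
    by_cases h : θ' j = some (iterAZ T' θ' (seqLimitZ T θ t) j)
    · right; intro k; simp only [FF]; rw [if_pos h]
    · have e := psi_step h
      rw [e]
      simp only [FF, if_neg h]
      exact ih

theorem FF_persist (T T' : Set ArcZ) (θ θ' : ℕ → Option ArcZ) (j : ℕ) (t : ArcZ)
    (h : ∀ k, FF T T' θ θ' k j t = iterAZ T' θ' (seqLimitZ T θ t) j) (i : ℕ) (hi : j ≤ i) :
    ∀ k, FF T T' θ θ' k i t = iterAZ T' θ' (seqLimitZ T θ t) i := by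
  induction i, hi using Nat.le_induction with
  | base => exact h
  | succ i hi ih =>
    intro k
    simp only [FF]
    split_ifs with hh
    · rfl
    · rw [psi_step hh, ih k]

theorem FF_tendsto {T T' : Set ArcZ} {θ θ' : ℕ → Option ArcZ} (hθ : AdmissibleZ T θ) (j : ℕ)
    {t : ArcZ} (ht : t ∈ T) :
    ∃ l, ∀ k, l ≤ k → FF T T' θ θ' k j t = iterAZ T' θ' (seqLimitZ T θ t) j := by
  rcases FF_dich T T' θ θ' j t with ⟨h1, h2⟩ | h
  · obtain ⟨l, hl⟩ := limit_spec (hθ.2.2 t ht)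
    exact ⟨l, fun k hk => by rw [h1, h2, hl k hk]⟩
  · exact ⟨0, fun k _ => h k⟩

theorem FF_tendsto_finite {T T' : Set ArcZ} {θ θ' : ℕ → Option ArcZ} (hθ : AdmissibleZ T θ)
    (j : ℕ) {L : Set ArcZ} (hL : L.Finite) (hLT : L ⊆ T) :
    ∃ l, ∀ k, l ≤ k → ∀ t ∈ L, FF T T' θ θ' k j t = iterAZ T' θ' (seqLimitZ T θ t) j := by
  have : ∀ᶠ k in Filter.atTop, ∀ t ∈ L,
      FF T T' θ θ' k j t = iterAZ T' θ' (seqLimitZ T θ t) j := by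
    rw [Filter.eventually_all_finite hL]
    intro t ht
    rw [Filter.eventually_atTop]
    exact FF_tendsto hθ j (hLT ht)
  exact Filter.eventually_atTop.1 this

theorem FF_lab {T T' : Set ArcZ} {θ θ' : ℕ → Option ArcZ} (hT : IsTriangulationZ T)
    (hT' : IsTriangulationZ T') (hθ : AdmissibleZ T θ) (hθ' : AdmissibleZ T' θ')
    (him : mutSeqZ T θ = T') (j : ℕ) :
    ∃ K, ∀ k, K ≤ k → Lab T (FF T T' θ θ' k j) := by
  induction j with
  | zero => exact ⟨0, fun k _ => (iter_lab hT hθ k).1⟩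
  | succ j ih =>
    obtain ⟨K, hK⟩ := ih
    cases hj : θ' j with
    | none =>
      refine ⟨K, fun k hk => ?_⟩
      have : FF T T' θ θ' k (j+1) = FF T T' θ θ' k j := by
        funext t; simp [FF, hj]
      rw [this]; exact hK k hk
    | some γ =>
      have hmut := hθ'.2.1 j γ hj
      obtain ⟨hl', hi'⟩ := iter_lab hT' hθ' j
      have htri : IsTriangulationZ (iterTZ T' θ' j) := by rw [← hi']; exact hl'.2
      have hexch := flip_exch hmut
      obtain ⟨_, hc, hsd⟩ := exch_facts htri hmut.1 hexch
      set γ' := flipArcZ (iterTZ T' θ' j) γ with hγ'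
      have himg : (fun t => iterAZ T' θ' (seqLimitZ T θ t) j) '' T = iterTZ T' θ' j := by
        have e1 := Set.image_image (fun u => iterAZ T' θ' u j) (seqLimitZ T θ) T
        have e2 : seqLimitZ T θ '' T = T' := him
        rw [← e1, e2]; exact hi'
      obtain ⟨b, hb, hbγ⟩ : γ ∈ (fun t => iterAZ T' θ' (seqLimitZ T θ t) j) '' T := by
        rw [himg]; exact hmut.1
      simp only at hbγ
      have hsub : sides γ γ' ⊆ (fun t => iterAZ T' θ' (seqLimitZ T θ t) j) '' T := by
        rw [himg]; exact fun w hw => (hsd hw).1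
      obtain ⟨L, hLT, hLfin, hLimg⟩ : ∃ L, L ⊆ T ∧ L.Finite ∧
          (fun t => iterAZ T' θ' (seqLimitZ T θ t) j) '' L = sides γ γ' := by
        obtain ⟨L, hLT, hbij⟩ := Set.SurjOn.exists_bijOn_subset (show Set.SurjOn
          (fun t => iterAZ T' θ' (seqLimitZ T θ t) j) T (sides γ γ') from hsub)
        refine ⟨L, hLT, ?_, hbij.image_eq⟩
        exact Set.Finite.of_finite_image (by rw [hbij.image_eq]; exact sides_finite γ γ')
          hbij.injOn
      obtain ⟨K2, hK2⟩ := FF_tendsto_finite (T' := T') (θ' := θ') hθ j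
        (hLfin.insert b) (Set.insert_subset hb hLT)
      refine ⟨max K K2, fun k hk => ?_⟩
      have hl := hK k (le_trans (le_max_left _ _) hk)
      have hk2 := hK2 k (le_trans (le_max_right _ _) hk)
      have hFb : FF T T' θ θ' k j b = γ := by rw [hk2 b (Set.mem_insert _ _), hbγ]
      have hFb' : FF T T' θ θ' k (j+1) b = γ' := by
        simp only [FF]
        rw [hbγ, if_pos hj]
        simp only [iterAZ, hj, stepAZ, mutArcZ]
        rw [if_pos hbγ]
      have hinj : ∀ s ∈ T, iterAZ T' θ' (seqLimitZ T θ s) j = γ → s = b := by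
        intro s hs hsγ
        apply limit_inj hT hθ hs hb
        have m : ∀ s ∈ T, seqLimitZ T θ s ∈ T' := by
          intro s hs; rw [← him]; exact ⟨s, hs, rfl⟩
        exact hl'.1 (m s hs) (m b hb) (hsγ.trans hbγ.symm)
      apply lab_update hl hb
      · intro s hs hsb
        simp only [FF]
        rw [if_neg]
        rw [hj]
        intro h
        exact hsb (hinj s hs (Option.some.inj h).symm)
      · rw [hFb, hFb']
        refine (exch_local hl.2 ⟨b, hb, hFb⟩ hc ?_).1
        rw [← hLimg]
        rintro _ ⟨t, ht, rfl⟩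
        exact ⟨t, hLT ht, hk2 t (Set.mem_insert_of_mem _ ht)⟩

theorem leS_trans' {T T' T'' : Set ArcZ} (hT : IsTriangulationZ T) (hT' : IsTriangulationZ T')
    (h : leS T T') (h' : leS T' T'') : leS T T'' := by
  obtain ⟨θ, hθ, him⟩ := h
  obtain ⟨θ', hθ', him'⟩ := h'
  choose K0 hK0 using FF_lab hT hT' hθ hθ' him
  let K : ℕ → ℕ := fun j => if j = 0 then 0 else max j (K0 j)
  have hKlab : ∀ j k, K j ≤ k → Lab T (FF T T' θ θ' k j) := by
    intro j k hk
    by_cases hj : j = 0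
    · subst hj; exact (iter_lab hT hθ k).1
    · simp only [K, if_neg hj] at hk
      exact hK0 j k (le_trans (le_max_right _ _) hk)
  have hKj : ∀ j, j ≤ K j := by
    intro j
    by_cases hj : j = 0
    · omega
    · simp only [K, if_neg hj]; exact le_max_left _ _
  let nx : ℕ × ℕ → ℕ × ℕ := fun p => if K (p.2+1) ≤ p.1 then (p.1, p.2+1) else (p.1+1, p.2)
  let P : ℕ → ℕ × ℕ := fun n => Nat.rec (0, 0) (fun _ p => nx p) n
  have hP : ∀ n, (K ((P n).2+1) ≤ (P n).1 ∧ (P (n+1)).1 = (P n).1 ∧ (P (n+1)).2 = (P n).2 + 1) ∨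
      (¬ K ((P n).2+1) ≤ (P n).1 ∧ (P (n+1)).1 = (P n).1 + 1 ∧ (P (n+1)).2 = (P n).2) := by
    intro n
    have e : P (n+1) = nx (P n) := rfl
    rw [e]
    by_cases h : K ((P n).2+1) ≤ (P n).1
    · left; simp only [nx, if_pos h]; exact ⟨h, trivial, trivial⟩
    · right; simp only [nx, if_neg h]; exact ⟨h, trivial, trivial⟩
  have hsum : ∀ n, (P n).1 + (P n).2 = n := by
    intro n
    induction n with
    | zero => rfl
    | succ n ih => rcases hP n with h | h <;> omega
  have hinv : ∀ n, K (P n).2 ≤ (P n).1 := by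
    intro n
    induction n with
    | zero => exact le_of_eq (if_pos rfl)
    | succ n ih =>
      rcases hP n with ⟨h1, h2, h3⟩ | ⟨h1, h2, h3⟩
      · rw [h2, h3]; exact h1
      · rw [h2, h3]; omega
  have hmono : ∀ n m, n ≤ m → (P n).2 ≤ (P m).2 := by
    intro n m h
    induction m, h using Nat.le_induction with
    | base => exact le_rfl
    | succ m _ ih => rcases hP m with h | h <;> omega
  have hj : ∀ J, ∃ n, ∀ m, n ≤ m → J ≤ (P m).2 := by
    intro J
    induction J with
    | zero => exact ⟨0, fun _ _ => Nat.zero_le _⟩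
    | succ J ih =>
      obtain ⟨n, hn⟩ := ih
      refine ⟨max n (K (J+1) + J) + 1, fun m hm => ?_⟩
      refine le_trans ?_ (hmono _ _ hm)
      set N := max n (K (J+1) + J) with hN
      have h1 : J ≤ (P N).2 := hn N (le_max_left _ _)
      have h2 : K (J+1) + J ≤ N := le_max_right _ _
      have h3 := hsum N
      by_cases he : (P N).2 = J
      · have := hP N
        rw [he] at this
        omega
      · have := hmono N (N+1) (by omega)
        omega
  have hk : ∀ n, n ≤ 2 * (P n).1 := by
    intro n
    have := hsum n
    have := hinv n
    have := hKj (P n).2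
    omega
  have hT'' : T'' = (fun t => seqLimitZ T' θ' (seqLimitZ T θ t)) '' T := by
    rw [← him']
    conv_lhs => rw [mutSeqZ]
    nth_rewrite 2 [← him]
    unfold mutSeqZ
    rw [Set.image_image]
  have hm : ∀ s ∈ T, seqLimitZ T θ s ∈ T' := by
    intro s hs; rw [← him]; exact ⟨s, hs, rfl⟩
  rw [hT'']
  apply leS_of_weak (fun n => FF T T' θ θ' (P n).1 (P n).2)
  · intro t _; rfl
  · intro n; exact hKlab _ _ (hinv n)
  · intro n s hs t ht h1 h2
    rcases hP n with ⟨_, e1, e2⟩ | ⟨_, e1, e2⟩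
    · simp only [e1, e2, FF] at h1 h2
      have q1 : θ' (P n).2 = some (iterAZ T' θ' (seqLimitZ T θ s) (P n).2) := by
        by_contra h; rw [if_neg h] at h1; exact h1 rfl
      have q2 : θ' (P n).2 = some (iterAZ T' θ' (seqLimitZ T θ t) (P n).2) := by
        by_contra h; rw [if_neg h] at h2; exact h2 rfl
      rw [q1] at q2
      exact limit_inj hT hθ hs ht
        ((iter_lab hT' hθ' (P n).2).1.1 (hm s hs) (hm t ht) (Option.some.inj q2))
    · simp only [e1, e2] at h1 h2
      have q : ∀ u, FF T T' θ θ' ((P n).1 + 1) (P n).2 u ≠ FF T T' θ θ' (P n).1 (P n).2 u →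
          iterAZ T θ u ((P n).1 + 1) ≠ iterAZ T θ u (P n).1 := by
        intro u hu
        rcases FF_dich T T' θ θ' (P n).2 u with ⟨h, _⟩ | h
        · rwa [h, h] at hu
        · rw [h, h] at hu; exact absurd rfl hu
      exact iter_diff hT hθ (P n).1 hs ht (q s h1) (q t h2)
  · intro t ht
    obtain ⟨l', hl'⟩ := limit_spec (hθ'.2.2 _ (hm t ht))
    by_cases hex : ∃ j, ∀ k, FF T T' θ θ' k j t = iterAZ T' θ' (seqLimitZ T θ t) j
    · obtain ⟨j, hjj⟩ := hex
      obtain ⟨N, hN⟩ := hj (max j l')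
      refine ⟨N, fun n hn => ?_⟩
      have h1 := hN n hn
      rw [FF_persist T T' θ θ' j t hjj _ (le_trans (le_max_left _ _) h1),
        hl' _ (le_trans (le_max_right _ _) h1)]
    · obtain ⟨l, hl⟩ := limit_spec (hθ.2.2 t ht)
      have hd : ∀ j, (∀ k, FF T T' θ θ' k j t = iterAZ T θ t k) ∧
          iterAZ T' θ' (seqLimitZ T θ t) j = seqLimitZ T θ t := by
        intro j
        rcases FF_dich T T' θ θ' j t with h | h
        · exact h
        · exact absurd ⟨j, h⟩ hex
      refine ⟨2 * l, fun n hn => ?_⟩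
      have := hk n
      rw [(hd _).1, hl _ (by omega), ← hl' l' le_rfl, (hd l').2]

theorem statement11 :
    (∀ T : Set ArcZ, IsTriangulationZ T → leS T T) ∧
    (∀ T T' T'' : Set ArcZ, IsTriangulationZ T → IsTriangulationZ T' → IsTriangulationZ T'' →
      leS T T' → leS T' T'' → leS T T'') := by
  refine ⟨fun T _ => ?_, fun T T' T'' hT hT' _ h h' => leS_trans' hT hT' h h'⟩
  have hit : ∀ t k, iterAZ T (fun _ => none) t k = t := by
    intro t k
    induction k with
    | zero => rfl
    | succ k ih => simpa [iterAZ, stepAZ] using ih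
  refine ⟨fun _ => none, ⟨fun _ _ => rfl, fun i γ h => by simp at h, fun t _ => ⟨0, fun k _ => ?_⟩⟩,
    ?_⟩
  · rw [hit, hit]
  · unfold mutSeqZ
    rw [Set.image_congr (fun t _ => limit_eq ⟨0, fun k _ => hit t k⟩)]
    simp
end
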